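/- Let n, r ≥ 1 be integers, N := n+r, and let c > 0, C₀ > 0 be given. Then there exist ε₀ > 0, δ₀ > 0 and C > 0, depending only on n, r, c, C₀, such that the following holds for every ε ∈ (0, ε₀] and every δ ∈ [0, δ₀]. Let A, K, M : ℝ → (N×N real matrices) and Q22 : ℝ → (r×r real matrices) be C¹ functions satisfying, for all x ∈ ℝ: A(x) is symmetric, K(x) is skew-symmetric, the operator norms of A(x), K(x), Q22(x), M(x) are at most C₀; wᵀQ22(x)w ≤ −c|w|² for all w ∈ ℝʳ; Wᵀ(K(x)A(x) − Q(x))W ≥ c|W|² for all W ∈ ℝᴺ, where Q(x) := diag(0_{n×n}, Q22(x)); the operator norms of A'(x), Q22'(x), K'(x) are at most C₀ε²; and (∫_ℝ ‖M'(x)‖² dx)^{1/2} ≤ C₀ ε^{5/2}. Write w_δ(x) := e^{δε⟨x⟩} with ⟨x⟩ := (1+x²)^{1/2}. Let f : ℝ → ℝⁿ be C² and g : ℝ → ℝʳ be C¹ with w_δ·∂_x^j f square integrable for j ≤ 2 and w_δ·∂_x^j g square integrable for j ≤ 1, and let U = (u, v) : ℝ → ℝⁿ×ℝʳ be C¹ with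 w_δ·U and w_δ·U' square integrable, satisfying for all x: A(x)U'(x) − Q(x)U(x) + ε²M(x)U(x) = (f'(x), g(x)). Then ‖w_δ U'‖_{L²} + ‖w_δ v‖_{L²} ≤ C( Σ_{j=0}^{2} ‖w_δ ∂_x^j f‖_{L²} + Σ_{j=0}^{1} ‖w_δ ∂_x^j g‖_{L²} + ε ‖w_δ u‖_{L²} ). -/

import Mathlib

open Matrix MeasureTheory Set

/-- Euclidean norm of a vector given as a function. -/
noncomputable def eNorm {ι : Type*} [Fintype ι] (x : ι → ℝ) : ℝ :=
  Real.sqrt (∑ i, x i ^ 2)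

/-- `L²(ℝ)` norm of a vector-valued function (Euclidean norm on values). -/
noncomputable def L2v {ι : Type*} [Fintype ι] (f : ℝ → ι → ℝ) : ℝ :=
  Real.sqrt (∫ x : ℝ, ∑ i, f x i ^ 2)

/-- Entrywise derivative of a matrix-valued function of a real variable. -/
noncomputable def derivM {ι κ : Type*} (M : ℝ → Matrix ι κ ℝ) (x : ℝ) : Matrix ι κ ℝ :=
  Matrix.of fun i j => deriv (fun t => M t i j) x

/-- The exponential weight `w_δ(x) = e^{δ ε ⟨x⟩}`, `⟨x⟩ = (1+x²)^{1/2}`. -/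
noncomputable def expWeight (δ ε x : ℝ) : ℝ :=
  Real.exp (δ * ε * Real.sqrt (1 + x ^ 2))

section EuclideanNorm

variable {ι κ : Type*} [Fintype ι] [Fintype κ]

lemma eNorm_nonneg (x : ι → ℝ) : 0 ≤ eNorm x := Real.sqrt_nonneg _

lemma eNorm_sq (x : ι → ℝ) : eNorm x ^ 2 = ∑ i, x i ^ 2 :=
  Real.sq_sqrt (Finset.sum_nonneg fun _ _ => sq_nonneg _)

lemma eNorm_eq_norm_toLp (x : ι → ℝ) : eNorm x = ‖WithLp.toLp 2 x‖ := by
  simp [eNorm, EuclideanSpace.norm_eq]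

lemma eNorm_add_le (x y : ι → ℝ) : eNorm (x + y) ≤ eNorm x + eNorm y := by
  simpa only [eNorm_eq_norm_toLp, WithLp.toLp_add] using norm_add_le _ _

lemma eNorm_sub_le (x y : ι → ℝ) : eNorm (x - y) ≤ eNorm x + eNorm y := by
  simpa only [eNorm_eq_norm_toLp, WithLp.toLp_sub] using norm_sub_le _ _

lemma eNorm_smul (t : ℝ) (x : ι → ℝ) : eNorm (t • x) = |t| * eNorm x := by
  simp only [eNorm_eq_norm_toLp, WithLp.toLp_smul, norm_smul, Real.norm_eq_abs]

lemma sum_smul_sq (t : ℝ) (x : ι → ℝ) : ∑ i, (t • x) i ^ 2 = t ^ 2 * eNorm x ^ 2 := by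
  rw [← eNorm_sq, eNorm_smul, mul_pow, sq_abs]

lemma abs_dotProduct_le (x y : ι → ℝ) : |x ⬝ᵥ y| ≤ eNorm x * eNorm y := by
  refine abs_le.2 ⟨?_, Real.sum_mul_le_sqrt_mul_sqrt _ _ _⟩
  have h := Real.sum_mul_le_sqrt_mul_sqrt Finset.univ (-x) y
  simp only [Pi.neg_apply, neg_mul, Finset.sum_neg_distrib, neg_sq] at h
  exact neg_le.1 h

lemma eNorm_sumElim_sq (x : ι → ℝ) (y : κ → ℝ) :
    eNorm (Sum.elim x y) ^ 2 = eNorm x ^ 2 + eNorm y ^ 2 := by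
  simp [eNorm_sq]

lemma eNorm_comp_inl_le (x : ι ⊕ κ → ℝ) : eNorm (x ∘ Sum.inl) ≤ eNorm x := by
  refine Real.sqrt_le_sqrt ?_
  rw [Fintype.sum_sum_type]
  exact le_add_of_nonneg_right (Finset.sum_nonneg fun _ _ => sq_nonneg _)

lemma eNorm_comp_inr_le (x : ι ⊕ κ → ℝ) : eNorm (x ∘ Sum.inr) ≤ eNorm x := by
  refine Real.sqrt_le_sqrt ?_
  rw [Fintype.sum_sum_type]
  exact le_add_of_nonneg_left (Finset.sum_nonneg fun _ _ => sq_nonneg _)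

lemma dotProduct_self_eq_eNorm_sq (x : ι → ℝ) : x ⬝ᵥ x = eNorm x ^ 2 := by
  rw [eNorm_sq]
  simp only [dotProduct, sq]

lemma continuous_eNorm {y : ℝ → ι → ℝ} (hy : Continuous y) :
    Continuous fun x => eNorm (y x) := by
  unfold eNorm
  fun_prop

lemma abs_dotProduct_mulVec_le {B : Matrix ι κ ℝ} {b : ℝ} (y : κ → ℝ)
    (hB : eNorm (B *ᵥ y) ≤ b * eNorm y) (x : ι → ℝ) :
    |x ⬝ᵥ (B *ᵥ y)| ≤ b * (eNorm x * eNorm y) := by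
  calc |x ⬝ᵥ (B *ᵥ y)| ≤ eNorm x * eNorm (B *ᵥ y) := abs_dotProduct_le _ _
    _ ≤ eNorm x * (b * eNorm y) := mul_le_mul_of_nonneg_left hB (eNorm_nonneg _)
    _ = _ := by ring

lemma dotProduct_mulVec_comm_of_isSymm {B : Matrix ι ι ℝ} (hB : B.IsSymm) (x y : ι → ℝ) :
    x ⬝ᵥ (B *ᵥ y) = y ⬝ᵥ (B *ᵥ x) := by
  rw [dotProduct_mulVec, ← mulVec_transpose, hB.eq, dotProduct_comm]

lemma sumElim_dotProduct_fromBlocks_mulVec (Q : Matrix κ κ ℝ) (x x' : ι → ℝ) (y y' : κ → ℝ) :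
    Sum.elim x y ⬝ᵥ (fromBlocks 0 0 0 Q *ᵥ Sum.elim x' y') = y ⬝ᵥ (Q *ᵥ y') := by
  simp [fromBlocks_mulVec]

end EuclideanNorm

section Derivatives

variable {ι κ : Type*}

lemma HasDerivAt.dotProduct [Fintype ι] {y z : ℝ → ι → ℝ} {y' z' : ι → ℝ} {x : ℝ}
    (hy : HasDerivAt y y' x) (hz : HasDerivAt z z' x) :
    HasDerivAt (fun t => y t ⬝ᵥ z t) (y' ⬝ᵥ z x + y x ⬝ᵥ z') x := by
  simp only [_root_.dotProduct, ← Finset.sum_add_distrib]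
  exact HasDerivAt.fun_sum fun i _ => (hasDerivAt_pi.1 hy i).mul (hasDerivAt_pi.1 hz i)

lemma hasDerivAt_derivM {B : ℝ → Matrix ι κ ℝ} (hB : ∀ i j, ContDiff ℝ 1 fun x => B x i j)
    (x : ℝ) (i : ι) (j : κ) : HasDerivAt (fun t => B t i j) (derivM B x i j) x :=
  ((hB i j).differentiable one_ne_zero x).hasDerivAt

lemma HasDerivAt.matrix_mulVec [Fintype κ] {B : ℝ → Matrix ι κ ℝ} {B' : Matrix ι κ ℝ}
    {y : ℝ → κ → ℝ} {y' : κ → ℝ} {x : ℝ} (hB : ∀ i j, HasDerivAt (fun t => B t i j) (B' i j) x)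
    (hy : HasDerivAt y y' x) :
    HasDerivAt (fun t => B t *ᵥ y t) (B' *ᵥ y x + B x *ᵥ y') x :=
  hasDerivAt_pi.2 fun i => (hasDerivAt_pi.2 fun j => hB i j).dotProduct hy

lemma HasDerivAt.sumElim {y : ℝ → ι → ℝ} {z : ℝ → κ → ℝ} {y' : ι → ℝ} {z' : κ → ℝ} {x : ℝ}
    (hy : HasDerivAt y y' x) (hz : HasDerivAt z z' x) :
    HasDerivAt (fun t => Sum.elim (y t) (z t)) (Sum.elim y' z') x := by
  refine hasDerivAt_pi.2 ?_
  rintro (i | i)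
  · exact hasDerivAt_pi.1 hy i
  · exact hasDerivAt_pi.1 hz i

/-- For symmetric `B` and merely continuous `y`, the quadratic form `y ⬝ᵥ B y` is differentiable
as soon as `B` and `B y` are. -/
lemma hasDerivAt_quadratic_of_isSymm [Fintype ι] {B : ℝ → Matrix ι ι ℝ} {B' : Matrix ι ι ℝ}
    {y : ℝ → ι → ℝ} {z' : ι → ℝ} {x : ℝ} (hsymm : ∀ t, (B t).IsSymm)
    (hB : ∀ i j, HasDerivAt (fun t => B t i j) (B' i j) x) (hy : ContinuousAt y x)
    (hz : HasDerivAt (fun t => B t *ᵥ y t) z' x) :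
    HasDerivAt (fun t => y t ⬝ᵥ (B t *ᵥ y t)) (2 * (y x ⬝ᵥ z') - y x ⬝ᵥ (B' *ᵥ y x)) x := by
  rw [hasDerivAt_iff_tendsto_slope]
  have hslope : ∀ t, slope (fun t => y t ⬝ᵥ (B t *ᵥ y t)) x t
      = (y t + y x) ⬝ᵥ slope (fun t => B t *ᵥ y t) x t
        - ∑ i, ∑ j, y x i * slope (fun s => B s i j) x t * y t j := by
    intro t
    have h1 : y t ⬝ᵥ (B x *ᵥ y x) = y x ⬝ᵥ (B x *ᵥ y t) :=
      dotProduct_mulVec_comm_of_isSymm (hsymm x) _ _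
    have h2 : ∑ i, ∑ j, y x i * slope (fun s => B s i j) x t * y t j
        = (t - x)⁻¹ * (y x ⬝ᵥ (B t *ᵥ y t) - y x ⬝ᵥ (B x *ᵥ y t)) := by
      simp only [_root_.dotProduct, mulVec, Finset.mul_sum, ← Finset.sum_sub_distrib,
        slope_def_field]
      refine Finset.sum_congr rfl fun i _ => Finset.sum_congr rfl fun j _ => ?_
      ring
    rw [h2, slope_def_field, slope_def_module, dotProduct_smul, dotProduct_sub, add_dotProduct,
      add_dotProduct, h1, smul_eq_mul]
    ring
  simp only [funext hslope]
  have hyx : Filter.Tendsto y (nhdsWithin x {x}ᶜ) (nhds (y x)) := hy.mono_left nhdsWithin_le_nhds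
  have hzx := hasDerivAt_iff_tendsto_slope.1 hz
  have hBx := fun i j => hasDerivAt_iff_tendsto_slope.1 (hB i j)
  have hlim : 2 * (y x ⬝ᵥ z') - y x ⬝ᵥ (B' *ᵥ y x)
      = (y x + y x) ⬝ᵥ z' - ∑ i, ∑ j, y x i * B' i j * y x j := by
    rw [add_dotProduct, two_mul]
    simp only [_root_.dotProduct, mulVec, Finset.mul_sum, mul_assoc]
  rw [hlim]
  refine Filter.Tendsto.sub ?_ ?_
  · exact tendsto_finsetSum _ fun i _ =>
      ((tendsto_pi_nhds.1 hyx i).add_const _).mul (tendsto_pi_nhds.1 hzx i)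
  · exact tendsto_finsetSum _ fun i _ => tendsto_finsetSum _ fun j _ =>
      ((hBx i j).const_mul _).mul (tendsto_pi_nhds.1 hyx j)

end Derivatives

section IntegralInequalities

lemma exists_gt_abs_lt_of_integrable {E : ℝ → ℝ} (hE : Integrable E) {η : ℝ} (hη : 0 < η)
    (R : ℝ) : ∃ x > R, |E x| < η := by
  by_contra! h
  have h1 : IntegrableOn (fun _ : ℝ => η) (Ioi R) := by
    refine Integrable.mono (hE.integrableOn (s := Ioi R)) aestronglyMeasurable_const ?_
    filter_upwards [ae_restrict_mem measurableSet_Ioi] with x hx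
    simpa [abs_of_pos hη] using h x hx
  rw [integrableOn_const_iff] at h1
  simp [hη.ne'] at h1

lemma exists_lt_abs_lt_of_integrable {E : ℝ → ℝ} (hE : Integrable E) {η : ℝ} (hη : 0 < η)
    (R : ℝ) : ∃ x < R, |E x| < η := by
  obtain ⟨x, hx, h⟩ := exists_gt_abs_lt_of_integrable hE.comp_neg hη (-R)
  exact ⟨-x, by linarith, h⟩

lemma sub_le_integral_of_hasDerivAt_le {E E' D : ℝ → ℝ} (hE' : ∀ x, HasDerivAt E (E' x) x)
    (hD : Integrable D) (hle : ∀ x, E' x ≤ D x) {a b : ℝ} (hab : a ≤ b) :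
    E b - E a ≤ ∫ x in a..b, D x :=
  intervalIntegral.sub_le_integral_of_hasDeriv_right_of_le hab
    (fun x _ => (hE' x).continuousAt.continuousWithinAt) (fun x _ => (hE' x).hasDerivWithinAt)
    hD.integrableOn (fun x _ => hle x)

lemma integral_nonneg_of_hasDerivAt_le {E E' D : ℝ → ℝ} (hE : Integrable E)
    (hE' : ∀ x, HasDerivAt E (E' x) x) (hD : Integrable D) (hle : ∀ x, E' x ≤ D x) :
    0 ≤ ∫ x, D x := by
  refine le_of_forall_pos_le_add fun η hη => ?_
  have hp : ∀ k : ℕ, ∃ x > (k : ℝ), |E x| < η / 2 :=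
    fun k => exists_gt_abs_lt_of_integrable hE (half_pos hη) k
  have hm : ∀ k : ℕ, ∃ x < -(k : ℝ), |E x| < η / 2 :=
    fun k => exists_lt_abs_lt_of_integrable hE (half_pos hη) _
  choose b hb hEb using hp
  choose a ha hEa using hm
  have hbt : Filter.Tendsto b Filter.atTop Filter.atTop :=
    Filter.tendsto_atTop_mono (fun k => (hb k).le) tendsto_natCast_atTop_atTop
  have hat : Filter.Tendsto a Filter.atTop Filter.atBot :=
    Filter.tendsto_atBot_mono (fun k => (ha k).le)
      (Filter.tendsto_neg_atTop_atBot.comp tendsto_natCast_atTop_atTop)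
  have hlim := (intervalIntegral_tendsto_integral hD hat hbt).add_const η
  refine ge_of_tendsto' hlim fun k => ?_
  have hab : a k ≤ b k := by
    have := ha k; have := hb k; have : (0 : ℝ) ≤ k := k.cast_nonneg
    linarith
  have h1 := sub_le_integral_of_hasDerivAt_le hE' hD hle hab
  have h2 := abs_lt.1 (hEa k)
  have h3 := abs_lt.1 (hEb k)
  linarith

lemma le_integral_of_hasDerivAt_le {E E' D : ℝ → ℝ} (hE : Integrable E)
    (hE' : ∀ x, HasDerivAt E (E' x) x) (hD : Integrable D) (hD0 : ∀ x, 0 ≤ D x)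
    (hle : ∀ x, E' x ≤ D x) (x : ℝ) : E x ≤ ∫ x, D x := by
  refine le_of_forall_pos_le_add fun η hη => ?_
  obtain ⟨y, hy, hEy⟩ := exists_lt_abs_lt_of_integrable hE hη x
  have h1 := sub_le_integral_of_hasDerivAt_le hE' hD hle hy.le
  have h2 : ∫ t in y..x, D t ≤ ∫ t, D t := by
    rw [intervalIntegral.integral_of_le hy.le]
    exact setIntegral_le_integral hD (Filter.Eventually.of_forall hD0)
  have h3 := abs_lt.1 hEy
  linarith

end IntegralInequalities

section PointwiseEstimates

lemma mul_le_young {t : ℝ} (ht : 0 < t) (x y : ℝ) : x * y ≤ t * x ^ 2 + 1 / (4 * t) * y ^ 2 := by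
  have h : t * x ^ 2 + 1 / (4 * t) * y ^ 2 - x * y = (2 * t * x - y) ^ 2 / (4 * t) := by
    field_simp
    ring
  have : 0 ≤ (2 * t * x - y) ^ 2 / (4 * t) := by positivity
  linarith

variable {ι κ : Type*} [Fintype ι] [Fintype κ]

/-- Pointwise dissipation of `v` in the undifferentiated energy identity. -/
lemma energy_identity_le {A dA M : Matrix (ι ⊕ κ) (ι ⊕ κ) ℝ} {Q : Matrix κ κ ℝ}
    {c C₀ ε a θ η : ℝ} {u u' f f' : ι → ℝ} {v v' g : κ → ℝ} {U Y : ι ⊕ κ → ℝ}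
    (hc : 0 < c) (hC₀ : 0 < C₀) (hε : 0 < ε) (ha : 0 ≤ a) (haε : a ≤ ε) (hθ : |θ| ≤ 1)
    (hη : 0 < η) (hU : U = Sum.elim u v) (hY : Y = Sum.elim u' v') (hsymm : A.IsSymm)
    (hA : eNorm (A *ᵥ U) ≤ C₀ * eNorm U) (hM : eNorm (M *ᵥ U) ≤ C₀ * eNorm U)
    (hdA : eNorm (dA *ᵥ U) ≤ C₀ * ε ^ 2 * eNorm U) (hQ : v ⬝ᵥ (Q *ᵥ v) ≤ -c * eNorm v ^ 2)
    (heq : A *ᵥ Y - fromBlocks 0 0 0 Q *ᵥ U + ε ^ 2 • (M *ᵥ U) = Sum.elim f' g) :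
    2 * a * θ * (1 / 2 * (U ⬝ᵥ (A *ᵥ U)) - u ⬝ᵥ f)
        + (1 / 2 * (Y ⬝ᵥ (A *ᵥ U) + U ⬝ᵥ (dA *ᵥ U + A *ᵥ Y)) - (u' ⬝ᵥ f + u ⬝ᵥ f'))
      ≤ -(c / 2) * eNorm v ^ 2 + 1 / 2 * (a / ε * eNorm ((A *ᵥ U) ∘ Sum.inl - f)) ^ 2
        + η * eNorm Y ^ 2 + (2 * C₀ + 1 + C₀ ^ 2 / c) * (ε ^ 2 * eNorm U ^ 2)
        + (1 / 2 + 1 / (4 * η)) * eNorm f ^ 2 + 1 / c * eNorm g ^ 2 := by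
  have hAY : A *ᵥ Y = fromBlocks 0 0 0 Q *ᵥ U - ε ^ 2 • (M *ᵥ U) + Sum.elim f' g := by
    rw [← heq]
    abel
  have h1 : U ⬝ᵥ (A *ᵥ Y) = v ⬝ᵥ (Q *ᵥ v) - ε ^ 2 * (U ⬝ᵥ (M *ᵥ U)) + (u ⬝ᵥ f' + v ⬝ᵥ g) := by
    rw [hAY, dotProduct_add, dotProduct_sub, dotProduct_smul, smul_eq_mul, hU,
      sumElim_dotProduct_fromBlocks_mulVec, sumElim_dotProduct_sumElim]
  have h2 : Y ⬝ᵥ (A *ᵥ U) = U ⬝ᵥ (A *ᵥ Y) := dotProduct_mulVec_comm_of_isSymm hsymm _ _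
  set h := (A *ᵥ U) ∘ Sum.inl - f with hh
  set p := (A *ᵥ U) ∘ Sum.inr with hp
  have h3 : U ⬝ᵥ (A *ᵥ U) = u ⬝ᵥ h + u ⬝ᵥ f + v ⬝ᵥ p := by
    rw [← dotProduct_add, hh, sub_add_cancel, ← sumElim_dotProduct_sumElim, hp,
      Sum.elim_comp_inl_inr, ← hU]
  have hu : eNorm u ≤ eNorm U := by simpa [hU] using eNorm_comp_inl_le (Sum.elim u v)
  have hu' : eNorm u' ≤ eNorm Y := by simpa [hY] using eNorm_comp_inl_le (Sum.elim u' v')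
  have hpn : eNorm p ≤ C₀ * eNorm U := (eNorm_comp_inr_le _).trans hA
  have b1 := (abs_le.1 (abs_dotProduct_mulVec_le U hM U)).1
  have b2 := (abs_le.1 (abs_dotProduct_mulVec_le U hdA U)).2
  have b3 := (abs_le.1 (abs_dotProduct_le v g)).2
  have b4 := (abs_le.1 (abs_dotProduct_le u' f)).1
  have b5 := abs_dotProduct_le u h
  have b6 := abs_dotProduct_le u f
  have b7 := abs_dotProduct_le v p
  have nU := eNorm_nonneg U
  have nv := eNorm_nonneg v
  have nh := eNorm_nonneg h
  have nf := eNorm_nonneg f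
  have m1 : eNorm u * eNorm h ≤ eNorm U * eNorm h := mul_le_mul_of_nonneg_right hu nh
  have m2 : eNorm u * eNorm f ≤ eNorm U * eNorm f := mul_le_mul_of_nonneg_right hu nf
  have m3 : eNorm v * eNorm p ≤ eNorm v * (C₀ * eNorm U) := mul_le_mul_of_nonneg_left hpn nv
  have m4 : eNorm u' * eNorm f ≤ eNorm Y * eNorm f := mul_le_mul_of_nonneg_right hu' nf
  have hT : |u ⬝ᵥ h + v ⬝ᵥ p - u ⬝ᵥ f|
      ≤ eNorm U * eNorm h + eNorm v * (C₀ * eNorm U) + eNorm U * eNorm f := by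
    rw [abs_le] at b5 b6 b7 ⊢
    constructor <;> linarith
  have hθT : a * (θ * (u ⬝ᵥ h + v ⬝ᵥ p - u ⬝ᵥ f))
      ≤ a * (eNorm U * eNorm h + eNorm v * (C₀ * eNorm U) + eNorm U * eNorm f) := by
    refine mul_le_mul_of_nonneg_left ((le_abs_self _).trans ?_) ha
    rw [abs_mul]
    exact (mul_le_of_le_one_left (abs_nonneg _) hθ).trans hT
  have y1 : a * (eNorm U * eNorm h) ≤ 1 / 2 * (a / ε * eNorm h) ^ 2
      + 1 / 2 * (ε ^ 2 * eNorm U ^ 2) := by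
    have := mul_le_young (one_half_pos (α := ℝ)) (a / ε * eNorm h) (ε * eNorm U)
    have e : a / ε * eNorm h * (ε * eNorm U) = a * (eNorm U * eNorm h) := by field_simp
    linarith
  have y2 : a * (eNorm U * eNorm f) ≤ 1 / 2 * (ε ^ 2 * eNorm U ^ 2) + 1 / 2 * eNorm f ^ 2 := by
    have := mul_le_young (one_half_pos (α := ℝ)) (ε * eNorm U) (eNorm f)
    have e := mul_le_mul_of_nonneg_right haε (mul_nonneg nU nf)
    linarith
  have y3 : a * (eNorm v * (C₀ * eNorm U)) ≤ c / 4 * eNorm v ^ 2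
      + C₀ ^ 2 / c * (ε ^ 2 * eNorm U ^ 2) := by
    have h0 := mul_le_young (show 0 < c / 4 by positivity) (eNorm v) (C₀ * (ε * eNorm U))
    have e := mul_le_mul_of_nonneg_right haε
      (mul_nonneg nv (mul_nonneg hC₀.le nU))
    have e2 : 1 / (4 * (c / 4)) * (C₀ * (ε * eNorm U)) ^ 2
      = C₀ ^ 2 / c * (ε ^ 2 * eNorm U ^ 2) := by field_simp
    linarith
  have y4 : eNorm v * eNorm g ≤ c / 4 * eNorm v ^ 2 + 1 / c * eNorm g ^ 2 := by
    have h0 := mul_le_young (show 0 < c / 4 by positivity) (eNorm v) (eNorm g)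
    rwa [mul_div_cancel₀ c (four_ne_zero)] at h0
  have y5 := mul_le_young hη (eNorm Y) (eNorm f)
  have b1' := mul_le_mul_of_nonneg_left b1 (sq_nonneg ε)
  have pos : 0 ≤ C₀ * (ε ^ 2 * eNorm U ^ 2) := by positivity
  rw [dotProduct_add, h2, h1, h3]
  linarith

/-- Pointwise dissipation of `v'` in the differentiated energy identity. -/
lemma differentiated_energy_identity_le {A dA M dM : Matrix (ι ⊕ κ) (ι ⊕ κ) ℝ}
    {Q dQ : Matrix κ κ ℝ} {c C₀ ε a θ η m : ℝ} {u u' f'' : ι → ℝ} {v v' g' : κ → ℝ}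
    {U Y z : ι ⊕ κ → ℝ}
    (hc : 0 < c) (hC₀ : 0 < C₀) (hε : 0 < ε) (hε1 : ε ≤ 1) (ha : 0 ≤ a) (haε : a ≤ ε)
    (hθ : |θ| ≤ 1) (hη : 0 < η) (hU : U = Sum.elim u v) (hY : Y = Sum.elim u' v')
    (hA : eNorm (A *ᵥ Y) ≤ C₀ * eNorm Y) (hM : eNorm (M *ᵥ Y) ≤ C₀ * eNorm Y)
    (hdA : eNorm (dA *ᵥ Y) ≤ C₀ * ε ^ 2 * eNorm Y)
    (hdM : eNorm (dM *ᵥ U) ≤ m * eNorm U)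
    (hdQ : eNorm (dQ *ᵥ v) ≤ C₀ * ε ^ 2 * eNorm v)
    (hQ : v' ⬝ᵥ (Q *ᵥ v') ≤ -c * eNorm v' ^ 2)
    (hz : z = Sum.elim (0 : ι → ℝ) (dQ *ᵥ v + Q *ᵥ v') - ε ^ 2 • (dM *ᵥ U + M *ᵥ Y)
      + Sum.elim f'' g') :
    a * θ * (Y ⬝ᵥ (A *ᵥ Y)) + 1 / 2 * (2 * (Y ⬝ᵥ z) - Y ⬝ᵥ (dA *ᵥ Y))
      ≤ -(c / 2) * eNorm v' ^ 2 + (3 * C₀ + 1) * (ε * eNorm Y ^ 2) + η * eNorm Y ^ 2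
        + ε ^ 2 * (m ^ 2 * eNorm U ^ 2) + C₀ ^ 2 / c * (ε ^ 2 * eNorm U ^ 2)
        + 1 / (4 * η) * eNorm f'' ^ 2 + 1 / c * eNorm g' ^ 2 := by
  have h1 : Y ⬝ᵥ z = v' ⬝ᵥ (dQ *ᵥ v) + v' ⬝ᵥ (Q *ᵥ v')
      - ε ^ 2 * (Y ⬝ᵥ (dM *ᵥ U) + Y ⬝ᵥ (M *ᵥ Y)) + (u' ⬝ᵥ f'' + v' ⬝ᵥ g') := by
    rw [hz, dotProduct_add, dotProduct_sub, dotProduct_smul, smul_eq_mul, dotProduct_add, hY,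
      sumElim_dotProduct_sumElim, sumElim_dotProduct_sumElim, dotProduct_zero, zero_add,
      dotProduct_add]
  have hv : eNorm v ≤ eNorm U := by simpa [hU] using eNorm_comp_inr_le (Sum.elim u v)
  have hu' : eNorm u' ≤ eNorm Y := by simpa [hY] using eNorm_comp_inl_le (Sum.elim u' v')
  have b1 := (abs_le.1 (abs_dotProduct_mulVec_le Y hM Y)).1
  have b2 := (abs_le.1 (abs_dotProduct_mulVec_le Y hdA Y)).1
  have b3 := (abs_le.1 (abs_dotProduct_le v' g')).2
  have b4 := (abs_le.1 (abs_dotProduct_le u' f'')).2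
  have b5 := (abs_le.1 (abs_dotProduct_mulVec_le U hdM Y)).1
  have b6 := (abs_le.1 (abs_dotProduct_mulVec_le v hdQ v')).2
  have b7 := abs_dotProduct_mulVec_le Y hA Y
  have nU := eNorm_nonneg U
  have nY := eNorm_nonneg Y
  have nv' := eNorm_nonneg v'
  have nf := eNorm_nonneg f''
  have hε2 : ε ^ 2 ≤ ε := by nlinarith
  have hθT : a * θ * (Y ⬝ᵥ (A *ᵥ Y)) ≤ C₀ * (ε * eNorm Y ^ 2) := by
    have e1 : θ * (Y ⬝ᵥ (A *ᵥ Y)) ≤ C₀ * (eNorm Y * eNorm Y) := by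
      refine (le_abs_self _).trans ?_
      rw [abs_mul]
      exact (mul_le_of_le_one_left (abs_nonneg _) hθ).trans b7
    have e2 := mul_le_mul_of_nonneg_left e1 ha
    have e3 := mul_le_mul_of_nonneg_right haε (show 0 ≤ C₀ * (eNorm Y * eNorm Y) by positivity)
    linarith
  have y1 : C₀ * ε ^ 2 * (eNorm v' * eNorm v) ≤ c / 4 * eNorm v' ^ 2
      + C₀ ^ 2 / c * (ε ^ 2 * eNorm U ^ 2) := by
    have h0 := mul_le_young (show 0 < c / 4 by positivity) (eNorm v') (C₀ * (ε * eNorm U))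
    have e : C₀ * ε ^ 2 * (eNorm v' * eNorm v) ≤ C₀ * ε * (eNorm v' * eNorm U) := by
      have := eNorm_nonneg v
      gcongr
    have e2 : 1 / (4 * (c / 4)) * (C₀ * (ε * eNorm U)) ^ 2
      = C₀ ^ 2 / c * (ε ^ 2 * eNorm U ^ 2) := by field_simp
    linarith
  have y2 : eNorm v' * eNorm g' ≤ c / 4 * eNorm v' ^ 2 + 1 / c * eNorm g' ^ 2 := by
    have h0 := mul_le_young (show 0 < c / 4 by positivity) (eNorm v') (eNorm g')
    rwa [mul_div_cancel₀ c (four_ne_zero)] at h0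
  have y3 : u' ⬝ᵥ f'' ≤ η * eNorm Y ^ 2 + 1 / (4 * η) * eNorm f'' ^ 2 :=
    (b4.trans (mul_le_mul_of_nonneg_right hu' nf)).trans (mul_le_young hη _ _)
  have y4 : ε ^ 2 * (m * (eNorm Y * eNorm U)) ≤ ε * eNorm Y ^ 2 + ε ^ 2 * (m ^ 2 * eNorm U ^ 2) := by
    have h0 := mul_le_young (one_pos (α := ℝ)) (eNorm Y) (m * eNorm U)
    have h1 : m * (eNorm Y * eNorm U) ≤ eNorm Y ^ 2 + m ^ 2 * eNorm U ^ 2 := by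
      have : 0 ≤ (m * eNorm U) ^ 2 := sq_nonneg _
      linarith
    have h2 := mul_le_mul_of_nonneg_left h1 (sq_nonneg ε)
    have h3 := mul_le_mul_of_nonneg_right hε2 (sq_nonneg (eNorm Y))
    linarith
  have y5 : C₀ * ε ^ 2 * (eNorm Y * eNorm Y) ≤ C₀ * (ε * eNorm Y ^ 2) := by
    have := mul_le_mul_of_nonneg_left (mul_le_mul_of_nonneg_right hε2 (sq_nonneg (eNorm Y))) hC₀.le
    linarith
  have b1' := mul_le_mul_of_nonneg_left b1 (sq_nonneg ε)
  have b5' := mul_le_mul_of_nonneg_left b5 (sq_nonneg ε)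
  have pos : 0 ≤ C₀ * (ε * eNorm Y ^ 2) := by positivity
  rw [h1]
  linarith

/-- The Kawashima compensator controls the full derivative by its dissipative part. -/
lemma kawashima_le {A K M : Matrix (ι ⊕ κ) (ι ⊕ κ) ℝ} {Q : Matrix κ κ ℝ}
    {c C₀ ε : ℝ} {u u' f' : ι → ℝ} {v v' g : κ → ℝ} {U Y : ι ⊕ κ → ℝ}
    (hc : 0 < c) (hC₀ : 0 < C₀) (hε : 0 < ε) (hε1 : ε ≤ 1)
    (hU : U = Sum.elim u v) (hY : Y = Sum.elim u' v')
    (hK : ∀ y, eNorm (K *ᵥ y) ≤ C₀ * eNorm y) (hM : eNorm (M *ᵥ U) ≤ C₀ * eNorm U)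
    (hQ : ∀ w, eNorm (Q *ᵥ w) ≤ C₀ * eNorm w)
    (hKA : c * eNorm Y ^ 2 ≤ Y ⬝ᵥ ((K * A - fromBlocks 0 0 0 Q) *ᵥ Y))
    (heq : A *ᵥ Y - fromBlocks 0 0 0 Q *ᵥ U + ε ^ 2 • (M *ᵥ U) = Sum.elim f' g) :
    eNorm Y ^ 2 ≤ (3 * C₀ ^ 2 * (C₀ ^ 2 + 1) / c ^ 2 + 2 * C₀ / c)
      * (eNorm v ^ 2 + eNorm v' ^ 2 + ε ^ 2 * eNorm U ^ 2 + (eNorm f' ^ 2 + eNorm g ^ 2)) := by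
  have hAY : A *ᵥ Y = Sum.elim (0 : ι → ℝ) (Q *ᵥ v) - ε ^ 2 • (M *ᵥ U) + Sum.elim f' g := by
    have : fromBlocks 0 0 0 Q *ᵥ U = Sum.elim (0 : ι → ℝ) (Q *ᵥ v) := by
      simp [hU, fromBlocks_mulVec]
    rw [← heq, this]
    abel
  set F := Sum.elim f' g with hF
  have hFn : eNorm F ^ 2 = eNorm f' ^ 2 + eNorm g ^ 2 := eNorm_sumElim_sq _ _
  have hQv : eNorm (Sum.elim (0 : ι → ℝ) (Q *ᵥ v)) ≤ C₀ * eNorm v := by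
    refine le_trans (le_of_eq ?_) (hQ v)
    simp [eNorm]
  have hz : eNorm (A *ᵥ Y) ≤ C₀ * eNorm v + ε * (C₀ * eNorm U) + eNorm F := by
    rw [hAY]
    refine (eNorm_add_le _ _).trans (add_le_add_left ?_ _)
    refine (eNorm_sub_le _ _).trans (add_le_add hQv ?_)
    rw [eNorm_smul, abs_of_nonneg (sq_nonneg ε)]
    exact mul_le_mul (by nlinarith) hM (eNorm_nonneg _) hε.le
  have hz2 : eNorm (A *ᵥ Y) ^ 2
      ≤ 3 * (C₀ ^ 2 * eNorm v ^ 2 + C₀ ^ 2 * (ε ^ 2 * eNorm U ^ 2) + eNorm F ^ 2) := by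
    have h1 := pow_le_pow_left₀ (eNorm_nonneg _) hz 2
    nlinarith [sq_nonneg (C₀ * eNorm v - ε * (C₀ * eNorm U)),
      sq_nonneg (C₀ * eNorm v - eNorm F), sq_nonneg (ε * (C₀ * eNorm U) - eNorm F)]
  have h1 : Y ⬝ᵥ ((K * A - fromBlocks 0 0 0 Q) *ᵥ Y)
      = Y ⬝ᵥ (K *ᵥ (A *ᵥ Y)) - v' ⬝ᵥ (Q *ᵥ v') := by
    rw [sub_mulVec, dotProduct_sub, mulVec_mulVec, hY, sumElim_dotProduct_fromBlocks_mulVec]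
  have b1 := (abs_le.1 (abs_dotProduct_mulVec_le (A *ᵥ Y) (hK _) Y)).2
  have b2 := (abs_le.1 (abs_dotProduct_mulVec_le v' (hQ _) v')).1
  have y1 := mul_le_young (show 0 < c / 2 by positivity) (eNorm Y) (C₀ * eNorm (A *ᵥ Y))
  have key : eNorm Y ^ 2 ≤ C₀ ^ 2 / c ^ 2 * eNorm (A *ᵥ Y) ^ 2 + 2 * C₀ / c * eNorm v' ^ 2 := by
    have e : c / 2 * (C₀ ^ 2 / c ^ 2 * eNorm (A *ᵥ Y) ^ 2 + 2 * C₀ / c * eNorm v' ^ 2)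
        = 1 / (4 * (c / 2)) * (C₀ * eNorm (A *ᵥ Y)) ^ 2 + C₀ * eNorm v' ^ 2 := by
      field_simp
      ring
    refine le_of_mul_le_mul_left ?_ (show 0 < c / 2 by positivity)
    rw [e]
    rw [h1] at hKA
    linarith
  have e1 := mul_le_mul_of_nonneg_left hz2 (show 0 ≤ C₀ ^ 2 / c ^ 2 by positivity)
  have e2 : (3 * C₀ ^ 2 * (C₀ ^ 2 + 1) / c ^ 2 + 2 * C₀ / c)
      * (eNorm v ^ 2 + eNorm v' ^ 2 + ε ^ 2 * eNorm U ^ 2 + (eNorm f' ^ 2 + eNorm g ^ 2))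
      = C₀ ^ 2 / c ^ 2
          * (3 * (C₀ ^ 2 * eNorm v ^ 2 + C₀ ^ 2 * (ε ^ 2 * eNorm U ^ 2) + eNorm F ^ 2))
        + 2 * C₀ / c * eNorm v' ^ 2
        + (3 * C₀ ^ 2 / c ^ 2 * (eNorm v ^ 2 + ε ^ 2 * eNorm U ^ 2 + C₀ ^ 2 * eNorm F ^ 2)
        + 3 * C₀ ^ 2 * (C₀ ^ 2 + 1) / c ^ 2 * eNorm v' ^ 2
        + 2 * C₀ / c * (eNorm v ^ 2 + ε ^ 2 * eNorm U ^ 2 + eNorm F ^ 2)) := by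
    rw [hFn]
    ring
  rw [e2]
  have : 0 ≤ 3 * C₀ ^ 2 / c ^ 2 * (eNorm v ^ 2 + ε ^ 2 * eNorm U ^ 2 + C₀ ^ 2 * eNorm F ^ 2)
        + 3 * C₀ ^ 2 * (C₀ ^ 2 + 1) / c ^ 2 * eNorm v' ^ 2
        + 2 * C₀ / c * (eNorm v ^ 2 + ε ^ 2 * eNorm U ^ 2 + eNorm F ^ 2) := by positivity
  linarith

end PointwiseEstimates

section Weight

lemma expWeight_sq (δ ε x : ℝ) :
    expWeight δ ε x ^ 2 = Real.exp (2 * (δ * ε) * Real.sqrt (1 + x ^ 2)) := by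
  rw [expWeight, ← Real.exp_nat_mul]
  ring_nf

lemma continuous_expWeight (δ ε : ℝ) : Continuous (expWeight δ ε) := by
  unfold expWeight
  fun_prop

lemma hasDerivAt_expWeight_sq (δ ε x : ℝ) :
    HasDerivAt (fun t => expWeight δ ε t ^ 2)
      (2 * (δ * ε) * (x / Real.sqrt (1 + x ^ 2)) * expWeight δ ε x ^ 2) x := by
  simp only [expWeight_sq]
  have h0 : (1 + x ^ 2 : ℝ) ≠ 0 := by positivity
  have h1 : HasDerivAt (fun t : ℝ => 1 + t ^ 2) (2 * x) x := by
    simpa using (hasDerivAt_pow 2 x).const_add 1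
  convert ((h1.sqrt h0).const_mul (2 * (δ * ε))).exp using 1
  ring

lemma abs_div_sqrt_one_add_sq_le_one (x : ℝ) : |x / Real.sqrt (1 + x ^ 2)| ≤ 1 := by
  rw [abs_div, abs_of_nonneg (Real.sqrt_nonneg _)]
  refine div_le_one_of_le₀ (Real.abs_le_sqrt ?_) (Real.sqrt_nonneg _)
  linarith

lemma cosh_le_expWeight_sq {δ ε : ℝ} (h : 0 ≤ δ * ε) (x : ℝ) :
    Real.cosh (2 * (δ * ε) * x) ≤ expWeight δ ε x ^ 2 := by
  have h1 : |2 * (δ * ε) * x| ≤ 2 * (δ * ε) * Real.sqrt (1 + x ^ 2) := by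
    rw [abs_mul, abs_of_nonneg (by positivity)]
    exact mul_le_mul_of_nonneg_left (Real.abs_le_sqrt (by linarith)) (by positivity)
  obtain ⟨h2, h3⟩ := abs_le.1 h1
  have e1 := Real.exp_le_exp.2 h3
  have e2 := Real.exp_le_exp.2 (neg_le.1 h2)
  rw [expWeight_sq, Real.cosh_eq]
  linarith

lemma expWeight_sq_le_cosh {δ ε : ℝ} (h : 0 ≤ δ * ε) (h1 : δ * ε ≤ 1) (x : ℝ) :
    expWeight δ ε x ^ 2 ≤ 16 * Real.cosh (2 * (δ * ε) * x) := by
  have hs : Real.sqrt (1 + x ^ 2) ≤ 1 + |x| := by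
    rw [Real.sqrt_le_left (by positivity)]
    nlinarith [abs_nonneg x, sq_abs x]
  have h2 : 2 * (δ * ε) * Real.sqrt (1 + x ^ 2) ≤ 1 + 1 + 2 * (δ * ε) * |x| := by
    have := mul_le_mul_of_nonneg_left hs (show 0 ≤ 2 * (δ * ε) by positivity)
    linarith
  have h3 : Real.exp (2 * (δ * ε) * |x|) ≤ 2 * Real.cosh (2 * (δ * ε) * x) := by
    have e : Real.cosh (2 * (δ * ε) * x) = Real.cosh (2 * (δ * ε) * |x|) := by
      rw [← Real.cosh_abs, abs_mul, abs_of_nonneg (show 0 ≤ 2 * (δ * ε) by positivity)]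
    rw [e, Real.cosh_eq]
    linarith [Real.exp_pos (-(2 * (δ * ε) * |x|))]
  have h4 : Real.exp 1 * Real.exp 1 ≤ 8 := by
    nlinarith [Real.exp_one_lt_d9, Real.exp_pos 1]
  rw [expWeight_sq]
  calc _ ≤ Real.exp (1 + 1 + 2 * (δ * ε) * |x|) := Real.exp_le_exp.2 h2
    _ = Real.exp 1 * Real.exp 1 * Real.exp (2 * (δ * ε) * |x|) := by rw [Real.exp_add, Real.exp_add]
    _ ≤ 8 * (2 * Real.cosh (2 * (δ * ε) * x)) :=
      mul_le_mul h4 h3 (Real.exp_pos _).le (by norm_num)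
    _ = _ := by ring

lemma abs_sinh_le_cosh (x : ℝ) : |Real.sinh x| ≤ Real.cosh x := by
  rw [abs_le, Real.sinh_eq, Real.cosh_eq]
  constructor <;> linarith [Real.exp_pos x, Real.exp_pos (-x)]

end Weight

section EnergyMethod

variable {ι κ : Type*} [Fintype ι] [Fintype κ]

/-- Pointwise form of the Hardy inequality `δ ε ‖w h‖ ≲ ‖w h'‖` for the exponential weight. -/
lemma hardy_weight_le {δ ε b x : ℝ} {h h' : ι → ℝ} (hε : 0 < ε) (hδ : 0 ≤ δ)
    (hδε : δ * ε ≤ 1) (hh' : eNorm h' ≤ 2 * b * ε ^ 2) :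
    -(8 * (δ / ε * (Real.cosh (2 * (δ * ε) * x) * (2 * (δ * ε)) * eNorm h ^ 2
        + Real.sinh (2 * (δ * ε) * x) * (2 * (h ⬝ᵥ h')))))
      ≤ expWeight δ ε x ^ 2 * (-(1 / 2) * (δ * ε / ε * eNorm h) ^ 2
        + 32 * (ε ^ 2 * b ^ 2)) := by
  set a := δ * ε with ha
  have ha0 : 0 ≤ a := by positivity
  set C := Real.cosh (2 * a * x) with hC
  have hC0 : 0 < C := Real.cosh_pos _
  have hW1 : C ≤ expWeight δ ε x ^ 2 := cosh_le_expWeight_sq ha0 x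
  have hW2 : expWeight δ ε x ^ 2 ≤ 16 * C := expWeight_sq_le_cosh ha0 hδε x
  have nh := eNorm_nonneg h
  have nh' := eNorm_nonneg h'
  have h1 : -(Real.sinh (2 * a * x) * (h ⬝ᵥ h')) ≤ C * (eNorm h * eNorm h') := by
    refine (neg_le_abs _).trans ?_
    rw [abs_mul]
    exact mul_le_mul (abs_sinh_le_cosh _) (abs_dotProduct_le h h') (abs_nonneg _) hC0.le
  have h2 : a * (a * (C * eNorm h ^ 2) * 2 + 2 * (Real.sinh (2 * a * x) * (h ⬝ᵥ h')))
      ≥ C * (a * eNorm h) ^ 2 - C * eNorm h' ^ 2 := by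
    have e1 := mul_le_mul_of_nonneg_left h1 ha0
    have e2 : 0 ≤ C * (a * eNorm h - eNorm h') ^ 2 := by positivity
    nlinarith
  have h3 : eNorm h' ^ 2 ≤ (2 * b * ε ^ 2) ^ 2 := pow_le_pow_left₀ nh' hh' 2
  have hδ' : δ / ε = a / ε ^ 2 := by
    rw [ha]
    field_simp
  have h4 : C * eNorm h' ^ 2 ≤ expWeight δ ε x ^ 2 * (2 * b * ε ^ 2) ^ 2 :=
    mul_le_mul hW1 h3 (sq_nonneg _) (sq_nonneg _)
  have h5 : expWeight δ ε x ^ 2 * (a * eNorm h) ^ 2 ≤ 16 * C * (a * eNorm h) ^ 2 :=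
    mul_le_mul_of_nonneg_right hW2 (sq_nonneg _)
  rw [hδ']
  refine le_of_mul_le_mul_left ?_ (show 0 < ε ^ 2 by positivity)
  have e1 : ε ^ 2 * -(8 * (a / ε ^ 2 * (C * (2 * a) * eNorm h ^ 2
        + Real.sinh (2 * a * x) * (2 * (h ⬝ᵥ h')))))
      = -8 * (a * (a * (C * eNorm h ^ 2) * 2 + 2 * (Real.sinh (2 * a * x) * (h ⬝ᵥ h')))) := by
    field_simp
  have e2 : ε ^ 2 * (expWeight δ ε x ^ 2 * (-(1 / 2) * (a / ε * eNorm h) ^ 2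
        + 32 * (ε ^ 2 * b ^ 2)))
      = -(1 / 2) * (expWeight δ ε x ^ 2 * (a * eNorm h) ^ 2)
        + 8 * (expWeight δ ε x ^ 2 * (2 * b * ε ^ 2) ^ 2) := by
    field_simp
    ring
  rw [e1, e2]
  linarith

/-- Weighted Sobolev bound: `w² |U|²` is controlled pointwise by the weighted `H¹` norm. -/
lemma expWeight_sq_mul_eNorm_sq_le {δ ε : ℝ} (h : 0 ≤ δ * ε) (h1 : δ * ε ≤ 1)
    {U Y : ℝ → ι → ℝ} (hU : ∀ x, HasDerivAt U (Y x) x)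
    (hIU : Integrable fun x => expWeight δ ε x ^ 2 * eNorm (U x) ^ 2)
    (hIY : Integrable fun x => expWeight δ ε x ^ 2 * eNorm (Y x) ^ 2) (x : ℝ) :
    expWeight δ ε x ^ 2 * eNorm (U x) ^ 2
      ≤ 3 * ((∫ x, expWeight δ ε x ^ 2 * eNorm (U x) ^ 2)
        + ∫ x, expWeight δ ε x ^ 2 * eNorm (Y x) ^ 2) := by
  rw [← integral_add hIU hIY, ← integral_const_mul]
  refine le_integral_of_hasDerivAt_le hIU (E' := fun x =>
    2 * (δ * ε) * (x / Real.sqrt (1 + x ^ 2)) * expWeight δ ε x ^ 2 * eNorm (U x) ^ 2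
      + expWeight δ ε x ^ 2 * (Y x ⬝ᵥ U x + U x ⬝ᵥ Y x)) (fun x => ?_)
    ((hIU.add hIY).const_mul 3) (fun x => ?_) (fun x => ?_) x
  · simp only [← dotProduct_self_eq_eNorm_sq]
    exact (hasDerivAt_expWeight_sq δ ε x).mul ((hU x).dotProduct (hU x))
  · simp only [Pi.add_apply]
    positivity
  · have hθ := (abs_le.1 (abs_div_sqrt_one_add_sq_le_one x)).2
    have b := (abs_le.1 (abs_dotProduct_le (U x) (Y x))).2
    have e1 : δ * ε * (x / Real.sqrt (1 + x ^ 2)) ≤ 1 :=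
      (mul_le_of_le_one_right h hθ).trans h1
    have e2 : 2 * (δ * ε * (x / Real.sqrt (1 + x ^ 2))) * eNorm (U x) ^ 2 + 2 * (U x ⬝ᵥ Y x)
        ≤ 3 * (eNorm (U x) ^ 2 + eNorm (Y x) ^ 2) := by
      have := mul_le_mul_of_nonneg_right e1 (sq_nonneg (eNorm (U x)))
      nlinarith [sq_nonneg (eNorm (U x) - eNorm (Y x)), sq_nonneg (eNorm (Y x))]
    have e3 := mul_le_mul_of_nonneg_left e2 (sq_nonneg (expWeight δ ε x))
    rw [dotProduct_comm (Y x), Pi.add_apply]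
    linarith

lemma integral_linear_combination {f₁ f₂ f₃ g₁ g₂ g₃ g₄ g₅ h : ℝ → ℝ}
    (hf₁ : Integrable f₁) (hf₂ : Integrable f₂) (hf₃ : Integrable f₃) (hg₁ : Integrable g₁)
    (hg₂ : Integrable g₂) (hg₃ : Integrable g₃) (hg₄ : Integrable g₄) (hg₅ : Integrable g₅)
    (hh : Integrable h) (a₁ a₂ a₃ b d : ℝ) :
    Integrable (fun x => a₁ * f₁ x + a₂ * f₂ x + a₃ * f₃ x
        + b * (g₁ x + g₂ x + g₃ x + g₄ x + g₅ x) + d * h x) ∧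
      ∫ x, (a₁ * f₁ x + a₂ * f₂ x + a₃ * f₃ x
        + b * (g₁ x + g₂ x + g₃ x + g₄ x + g₅ x) + d * h x)
      = a₁ * (∫ x, f₁ x) + a₂ * (∫ x, f₂ x) + a₃ * (∫ x, f₃ x)
        + b * ((∫ x, g₁ x) + (∫ x, g₂ x) + (∫ x, g₃ x) + (∫ x, g₄ x) + (∫ x, g₅ x))
        + d * ∫ x, h x := by
  have hadd := fun {F G : ℝ → ℝ} {p q : ℝ} (hF : Integrable F ∧ ∫ x, F x = p)
      (hG : Integrable G ∧ ∫ x, G x = q) =>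
    show Integrable (fun x => F x + G x) ∧ ∫ x, (F x + G x) = p + q from
      ⟨hF.1.add hG.1, (integral_add hF.1 hG.1).trans (congrArg₂ (· + ·) hF.2 hG.2)⟩
  have hsmul := fun (a : ℝ) {F : ℝ → ℝ} {p : ℝ} (hF : Integrable F ∧ ∫ x, F x = p) =>
    show Integrable (fun x => a * F x) ∧ ∫ x, a * F x = a * p from
      ⟨hF.1.const_mul a, (integral_const_mul a F).trans (congrArg (a * ·) hF.2)⟩
  exact hadd (hadd (hadd (hadd (hsmul a₁ ⟨hf₁, rfl⟩) (hsmul a₂ ⟨hf₂, rfl⟩)) (hsmul a₃ ⟨hf₃, rfl⟩))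
    (hsmul b (hadd (hadd (hadd (hadd ⟨hg₁, rfl⟩ ⟨hg₂, rfl⟩) ⟨hg₃, rfl⟩) ⟨hg₄, rfl⟩) ⟨hg₅, rfl⟩)))
    (hsmul d ⟨hh, rfl⟩)

/-- Integrated energy estimate, before absorbing the terms carrying a factor `ε`. -/
lemma weighted_energy_integral_le {A K M dA dM : ℝ → Matrix (ι ⊕ κ) (ι ⊕ κ) ℝ}
    {Q dQ : ℝ → Matrix κ κ ℝ} {c C₀ ε δ k : ℝ} {m : ℝ → ℝ}
    {u u' f f' f'' : ℝ → ι → ℝ} {v v' g g' : ℝ → κ → ℝ} {U Y : ℝ → ι ⊕ κ → ℝ}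
    (hc : 0 < c) (hC₀ : 0 < C₀) (hε : 0 < ε) (hε1 : ε ≤ 1) (hδ : 0 ≤ δ) (hδ1 : δ ≤ 1)
    (hk : k = 3 * C₀ ^ 2 * (C₀ ^ 2 + 1) / c ^ 2 + 2 * C₀ / c)
    (hU : ∀ x, U x = Sum.elim (u x) (v x)) (hY : ∀ x, Y x = Sum.elim (u' x) (v' x))
    (hdA : ∀ x i j, HasDerivAt (fun t => A t i j) (dA x i j) x)
    (hdM : ∀ x i j, HasDerivAt (fun t => M t i j) (dM x i j) x)
    (hdQ : ∀ x i j, HasDerivAt (fun t => Q t i j) (dQ x i j) x)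
    (hdf : ∀ x, HasDerivAt f (f' x) x) (hdf' : ∀ x, HasDerivAt f' (f'' x) x)
    (hdg : ∀ x, HasDerivAt g (g' x) x)
    (hdu : ∀ x, HasDerivAt u (u' x) x) (hdv : ∀ x, HasDerivAt v (v' x) x)
    (hYc : Continuous Y)
    (hsymm : ∀ x, (A x).IsSymm)
    (hA : ∀ x y, eNorm (A x *ᵥ y) ≤ C₀ * eNorm y)
    (hK : ∀ x y, eNorm (K x *ᵥ y) ≤ C₀ * eNorm y)
    (hM : ∀ x y, eNorm (M x *ᵥ y) ≤ C₀ * eNorm y)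
    (hQ : ∀ x w, eNorm (Q x *ᵥ w) ≤ C₀ * eNorm w)
    (hQc : ∀ x w, w ⬝ᵥ (Q x *ᵥ w) ≤ -c * eNorm w ^ 2)
    (hKA : ∀ x W, c * eNorm W ^ 2 ≤ W ⬝ᵥ ((K x * A x - fromBlocks 0 0 0 (Q x)) *ᵥ W))
    (hdAb : ∀ x y, eNorm (dA x *ᵥ y) ≤ C₀ * ε ^ 2 * eNorm y)
    (hdQb : ∀ x w, eNorm (dQ x *ᵥ w) ≤ C₀ * ε ^ 2 * eNorm w)
    (hdMb : ∀ x y, eNorm (dM x *ᵥ y) ≤ m x * eNorm y)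
    (hm : Integrable fun x => m x ^ 2)
    (hIf : Integrable fun x => expWeight δ ε x ^ 2 * eNorm (f x) ^ 2)
    (hIf' : Integrable fun x => expWeight δ ε x ^ 2 * eNorm (f' x) ^ 2)
    (hIf'' : Integrable fun x => expWeight δ ε x ^ 2 * eNorm (f'' x) ^ 2)
    (hIg : Integrable fun x => expWeight δ ε x ^ 2 * eNorm (g x) ^ 2)
    (hIg' : Integrable fun x => expWeight δ ε x ^ 2 * eNorm (g' x) ^ 2)
    (hIv : Integrable fun x => expWeight δ ε x ^ 2 * eNorm (v x) ^ 2)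
    (hIU : Integrable fun x => expWeight δ ε x ^ 2 * eNorm (U x) ^ 2)
    (hIY : Integrable fun x => expWeight δ ε x ^ 2 * eNorm (Y x) ^ 2)
    (heq : ∀ x, A x *ᵥ Y x - fromBlocks 0 0 0 (Q x) *ᵥ U x + ε ^ 2 • (M x *ᵥ U x)
      = Sum.elim (f' x) (g x)) :
    c / 4 * (∫ x, expWeight δ ε x ^ 2 * eNorm (v x) ^ 2)
        + 3 * c / (16 * k) * (∫ x, expWeight δ ε x ^ 2 * eNorm (Y x) ^ 2)
      ≤ (3 * C₀ + 1) * ε * (∫ x, expWeight δ ε x ^ 2 * eNorm (Y x) ^ 2)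
        + (2 * C₀ + 1 + 2 * C₀ ^ 2 / c + 32 * C₀ ^ 2 + c / 4) * ε ^ 2
          * (∫ x, expWeight δ ε x ^ 2 * eNorm (U x) ^ 2)
        + (1 / 2 + 8 * k / c + 2 / c + c / 4)
          * ((∫ x, expWeight δ ε x ^ 2 * eNorm (f x) ^ 2)
            + (∫ x, expWeight δ ε x ^ 2 * eNorm (f' x) ^ 2)
            + (∫ x, expWeight δ ε x ^ 2 * eNorm (f'' x) ^ 2)
            + (∫ x, expWeight δ ε x ^ 2 * eNorm (g x) ^ 2)
            + (∫ x, expWeight δ ε x ^ 2 * eNorm (g' x) ^ 2))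
        + ε ^ 2 * (∫ x, m x ^ 2)
          * (3 * ((∫ x, expWeight δ ε x ^ 2 * eNorm (U x) ^ 2)
            + ∫ x, expWeight δ ε x ^ 2 * eNorm (Y x) ^ 2)) := by
  have hk0 : 0 < k := by rw [hk]; positivity
  have ha0 : 0 ≤ δ * ε := by positivity
  have haε : δ * ε ≤ ε := mul_le_of_le_one_left hε.le hδ1
  have ha1 : δ * ε ≤ 1 := haε.trans hε1
  have hdU : ∀ x, HasDerivAt U (Y x) x := fun x => by
    rw [funext hU, hY]
    exact (hdu x).sumElim (hdv x)
  set S := 3 * ((∫ x, expWeight δ ε x ^ 2 * eNorm (U x) ^ 2)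
    + ∫ x, expWeight δ ε x ^ 2 * eNorm (Y x) ^ 2)
  have hsup : ∀ x, expWeight δ ε x ^ 2 * eNorm (U x) ^ 2 ≤ S := fun x =>
    expWeight_sq_mul_eNorm_sq_le ha0 ha1 hdU hIU hIY x
  have hAY : ∀ x, A x *ᵥ Y x
      = Sum.elim (0 : ι → ℝ) (Q x *ᵥ v x) - ε ^ 2 • (M x *ᵥ U x)
        + Sum.elim (f' x) (g x) := fun x => by
    have : fromBlocks 0 0 0 (Q x) *ᵥ U x = Sum.elim (0 : ι → ℝ) (Q x *ᵥ v x) := by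
      simp [hU, fromBlocks_mulVec]
    rw [← heq, this]
    abel
  let z' : ℝ → ι ⊕ κ → ℝ := fun x => Sum.elim (0 : ι → ℝ) (dQ x *ᵥ v x + Q x *ᵥ v' x)
    - ε ^ 2 • (dM x *ᵥ U x + M x *ᵥ Y x) + Sum.elim (f'' x) (g' x)
  have hz : ∀ x, HasDerivAt (fun t => A t *ᵥ Y t) (z' x) x := fun x => by
    rw [funext hAY]
    exact (((hasDerivAt_const x (0 : ι → ℝ)).sumElim
      (HasDerivAt.matrix_mulVec (hdQ x) (hdv x))).sub
      ((HasDerivAt.matrix_mulVec (hdM x) (hdU x)).const_smul (ε ^ 2))).add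
      ((hdf' x).sumElim (hdg x))
  have hq := fun x => hasDerivAt_quadratic_of_isSymm hsymm (hdA x) hYc.continuousAt (hz x)
  let h : ℝ → ι → ℝ := fun x => (A x *ᵥ U x) ∘ Sum.inl - f x
  let h' : ℝ → ι → ℝ := fun x => (dA x *ᵥ U x + A x *ᵥ Y x) ∘ Sum.inl - f' x
  have hAU := fun x => HasDerivAt.matrix_mulVec (hdA x) (hdU x)
  have hdh : ∀ x, HasDerivAt h (h' x) x := fun x =>
    (hasDerivAt_pi.2 fun i => hasDerivAt_pi.1 (hAU x) (Sum.inl i)).sub (hdf x)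
  have hh'b : ∀ x, eNorm (h' x) ≤ 2 * (C₀ * eNorm (U x)) * ε ^ 2 := fun x => by
    have e : h' x = (dA x *ᵥ U x - ε ^ 2 • (M x *ᵥ U x)) ∘ Sum.inl := by
      ext i
      simp [h', hAY]
      ring
    rw [e]
    refine (eNorm_comp_inl_le _).trans ((eNorm_sub_le _ _).trans ?_)
    rw [eNorm_smul, abs_of_nonneg (sq_nonneg ε)]
    have e1 := hdAb x (U x)
    have e2 := mul_le_mul_of_nonneg_left (hM x (U x)) (sq_nonneg ε)
    linarith
  have hhb : ∀ x, eNorm (h x) ^ 2 ≤ 2 * (C₀ ^ 2 * eNorm (U x) ^ 2 + eNorm (f x) ^ 2) := fun x => by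
    have e1 : eNorm (h x) ≤ C₀ * eNorm (U x) + eNorm (f x) :=
      (eNorm_sub_le _ _).trans (add_le_add_left ((eNorm_comp_inl_le _).trans (hA x (U x))) _)
    have e2 := pow_le_pow_left₀ (eNorm_nonneg _) e1 2
    nlinarith [sq_nonneg (C₀ * eNorm (U x) - eNorm (f x))]
  have hsinh : ∀ x, HasDerivAt (fun t => Real.sinh (2 * (δ * ε) * t))
      (Real.cosh (2 * (δ * ε) * x) * (2 * (δ * ε))) x := fun x => by
    simpa using ((hasDerivAt_id x).const_mul (2 * (δ * ε))).sinh
  let W : ℝ → ℝ := fun x => expWeight δ ε x ^ 2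
  have hW0 : ∀ x, 0 ≤ W x := fun x => sq_nonneg _
  let E : ℝ → ℝ := fun x => W x * (1 / 2 * (U x ⬝ᵥ (A x *ᵥ U x)) - u x ⬝ᵥ f x)
    + W x * (1 / 2 * (Y x ⬝ᵥ (A x *ᵥ Y x)))
    - 8 * (δ / ε * (Real.sinh (2 * (δ * ε) * x) * (h x ⬝ᵥ h x)))
  have hE' := fun x => (((hasDerivAt_expWeight_sq δ ε x).mul
      ((((hdU x).dotProduct (hAU x)).const_mul (1 / 2)).sub ((hdu x).dotProduct (hdf x)))).add
    ((hasDerivAt_expWeight_sq δ ε x).mul ((hq x).const_mul (1 / 2)))).sub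
    ((((hsinh x).mul ((hdh x).dotProduct (hdh x))).const_mul (δ / ε)).const_mul 8)
  have hEc : Continuous E := continuous_iff_continuousAt.2 fun x => (hE' x).continuousAt
  have hEI : Integrable E := by
    refine Integrable.mono' (g := fun x => (C₀ / 2 + 1) * (W x * eNorm (U x) ^ 2)
      + W x * eNorm (f x) ^ 2 + C₀ / 2 * (W x * eNorm (Y x) ^ 2)
      + 16 * (δ / ε) * (C₀ ^ 2 * (W x * eNorm (U x) ^ 2) + W x * eNorm (f x) ^ 2))
      ((((hIU.const_mul _).add hIf).add (hIY.const_mul _)).add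
        (((hIU.const_mul _).add hIf).const_mul _)) hEc.aestronglyMeasurable
      (Filter.Eventually.of_forall fun x => ?_)
    have b1 := abs_dotProduct_mulVec_le (U x) (hA x _) (U x)
    have b2 := abs_dotProduct_mulVec_le (Y x) (hA x _) (Y x)
    have b3 := abs_dotProduct_le (u x) (f x)
    have hu : eNorm (u x) ≤ eNorm (U x) := by
      simpa [hU] using eNorm_comp_inl_le (Sum.elim (u x) (v x))
    have b4 : |u x ⬝ᵥ f x| ≤ eNorm (U x) ^ 2 + eNorm (f x) ^ 2 := by
      nlinarith [mul_le_mul_of_nonneg_right hu (eNorm_nonneg (f x)),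
        sq_nonneg (eNorm (U x) - eNorm (f x)), sq_nonneg (eNorm (U x)), sq_nonneg (eNorm (f x))]
    have b5 : |W x * (1 / 2 * (U x ⬝ᵥ (A x *ᵥ U x)) - u x ⬝ᵥ f x)
        + W x * (1 / 2 * (Y x ⬝ᵥ (A x *ᵥ Y x)))|
        ≤ W x * ((C₀ / 2 + 1) * eNorm (U x) ^ 2 + eNorm (f x) ^ 2 + C₀ / 2 * eNorm (Y x) ^ 2) := by
      rw [← mul_add, abs_mul, abs_of_nonneg (hW0 x)]
      refine mul_le_mul_of_nonneg_left ?_ (hW0 x)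
      rw [abs_le] at b1 b2 b4 ⊢
      constructor <;> linarith
    have b6 : |8 * (δ / ε * (Real.sinh (2 * (δ * ε) * x) * (h x ⬝ᵥ h x)))|
        ≤ 8 * (δ / ε * (W x * (2 * (C₀ ^ 2 * eNorm (U x) ^ 2 + eNorm (f x) ^ 2)))) := by
      rw [dotProduct_self_eq_eNorm_sq, abs_mul, abs_mul, abs_mul,
        abs_of_nonneg (show 0 ≤ δ / ε by positivity),
        abs_of_nonneg (sq_nonneg (eNorm (h x))), abs_of_nonneg (show (0 : ℝ) ≤ 8 by norm_num)]
      refine mul_le_mul_of_nonneg_left (mul_le_mul_of_nonneg_left ?_ (by positivity)) (by norm_num)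
      exact mul_le_mul ((abs_sinh_le_cosh _).trans (cosh_le_expWeight_sq ha0 x)) (hhb x)
        (sq_nonneg _) (hW0 x)
    rw [Real.norm_eq_abs]
    refine (abs_sub _ _).trans ((add_le_add b5 b6).trans (le_of_eq ?_))
    ring
  let D : ℝ → ℝ := fun x => -(c / 4) * (W x * eNorm (v x) ^ 2)
    + (-(3 * c / (16 * k)) + (3 * C₀ + 1) * ε) * (W x * eNorm (Y x) ^ 2)
    + (2 * C₀ + 1 + 2 * C₀ ^ 2 / c + 32 * C₀ ^ 2 + c / 4) * ε ^ 2 * (W x * eNorm (U x) ^ 2)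
    + (1 / 2 + 8 * k / c + 2 / c + c / 4) * (W x * eNorm (f x) ^ 2 + W x * eNorm (f' x) ^ 2
      + W x * eNorm (f'' x) ^ 2 + W x * eNorm (g x) ^ 2 + W x * eNorm (g' x) ^ 2)
    + ε ^ 2 * S * m x ^ 2
  obtain ⟨hDI, hint⟩ := integral_linear_combination hIv hIY hIU hIf hIf' hIf'' hIg hIg' hm
    (-(c / 4)) (-(3 * c / (16 * k)) + (3 * C₀ + 1) * ε)
    ((2 * C₀ + 1 + 2 * C₀ ^ 2 / c + 32 * C₀ ^ 2 + c / 4) * ε ^ 2)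
    (1 / 2 + 8 * k / c + 2 / c + c / 4) (ε ^ 2 * S)
  have hle := integral_nonneg_of_hasDerivAt_le hEI (D := D) hE' hDI fun x => by
    have hη : 0 < c / (32 * k) := by positivity
    have hθ := abs_div_sqrt_one_add_sq_le_one x
    have p1 := energy_identity_le hc hC₀ hε ha0 haε hθ hη (hU x) (hY x) (hsymm x)
      (hA x _) (hM x _) (hdAb x _) (hQc x _) (f := f x) (heq x)
    have p2 := differentiated_energy_identity_le hc hC₀ hε hε1 ha0 haε hθ hη (hU x) (hY x)
      (hA x _) (hM x _) (hdAb x _) (hdMb x _) (hdQb x _) (hQc x _)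
      (f'' := f'' x) (g' := g' x) (z := z' x) rfl
    have p3 := kawashima_le hc hC₀ hε hε1 (hU x) (hY x) (hK x) (hM x _) (hQ x) (hKA x _) (heq x)
    have p4 := hardy_weight_le (x := x) (h := h x) hε hδ ha1 (hh'b x)
    rw [← hk] at p3
    have hη' : 1 / (4 * (c / (32 * k))) = 8 * k / c := by
      field_simp
      norm_num
    rw [hη'] at p1 p2
    have r1 := mul_le_mul_of_nonneg_left p1 (hW0 x)
    have r2 := mul_le_mul_of_nonneg_left p2 (hW0 x)
    have r3 : W x * (c / (4 * k) * eNorm (Y x) ^ 2)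
        ≤ W x * (c / 4 * (eNorm (v x) ^ 2 + eNorm (v' x) ^ 2 + ε ^ 2 * eNorm (U x) ^ 2
          + (eNorm (f' x) ^ 2 + eNorm (g x) ^ 2))) := by
      refine mul_le_mul_of_nonneg_left ?_ (hW0 x)
      refine (mul_le_mul_of_nonneg_left p3 (by positivity)).trans (le_of_eq ?_)
      field_simp
    have r5 := mul_le_mul_of_nonneg_left (hsup x) (show 0 ≤ ε ^ 2 * m x ^ 2 by positivity)
    have s1 : 0 ≤ (2 / c + c / 4) * (W x * eNorm (f x) ^ 2) := by positivity
    have s2 : 0 ≤ (1 / 2 + 8 * k / c + 2 / c) * (W x * eNorm (f' x) ^ 2) := by positivity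
    have s3 : 0 ≤ (1 / 2 + 2 / c + c / 4) * (W x * eNorm (f'' x) ^ 2) := by positivity
    have s4 : 0 ≤ (1 / 2 + 8 * k / c + 1 / c) * (W x * eNorm (g x) ^ 2) := by positivity
    have s5 : 0 ≤ (1 / 2 + 8 * k / c + 1 / c + c / 4) * (W x * eNorm (g' x) ^ 2) := by positivity
    have s6 : 0 ≤ c / 4 * (W x * eNorm (v' x) ^ 2) := by positivity
    have total := add_le_add (add_le_add r1 r2) p4
    refine le_trans (le_of_eq ?_) (total.trans ?_)
    · simp only [W, Pi.sub_apply, dotProduct_self_eq_eNorm_sq, dotProduct_comm (h' x)]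
      ring
    · simp only [D, W, h] at r3 r5 s1 s2 s3 s4 s5 s6 ⊢
      rw [← sub_nonneg] at r3 r5 ⊢
      refine (add_nonneg (add_nonneg (add_nonneg (add_nonneg (add_nonneg (add_nonneg (add_nonneg
        r3 r5) s1) s2) s3) s4) s5) s6).trans (le_of_eq ?_)
      ring
  rw [show ∫ x, D x = _ from hint] at hle
  linarith

end EnergyMethod

section Absorption

lemma absorbed_energy_le {p q a b d B C₀ ε Iv Iu IY F J : ℝ} (hC₀ : 0 < C₀) (hε : 0 < ε)
    (hε1 : ε ≤ 1) (hIv : 0 ≤ Iv) (hIu : 0 ≤ Iu) (hIY : 0 ≤ IY)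
    (ha : (a + 3 * C₀ ^ 2) * ε ≤ q) (hb : (b + 3 * C₀ ^ 2) * ε ≤ p) (hba : 0 < b)
    (hJ : J ≤ C₀ ^ 2 * ε ^ 2)
    (h : 2 * p * Iv + d * IY ≤ a * ε * IY + b * ε ^ 2 * (Iu + Iv) + B * F
      + ε ^ 2 * J * (3 * ((Iu + Iv) + IY))) :
    p * Iv + (d - q) * IY ≤ (b + 3 * C₀ ^ 2) * (ε ^ 2 * Iu) + B * F := by
  have hε2 : ε ^ 2 ≤ ε := by nlinarith
  have hε3 : ε ^ 2 ≤ 1 := hε2.trans hε1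
  have hJε : ε ^ 2 * J * (3 * ((Iu + Iv) + IY))
      ≤ 3 * C₀ ^ 2 * (ε ^ 2 * (Iu + Iv) + ε * IY) := by
    have e1 : ε ^ 2 * J ≤ C₀ ^ 2 * ε ^ 2 := by
      have h1 := mul_le_mul_of_nonneg_left hJ (sq_nonneg ε)
      have h2 := mul_le_mul_of_nonneg_right hε3 (show 0 ≤ C₀ ^ 2 * ε ^ 2 by positivity)
      linarith
    have e2 := mul_le_mul_of_nonneg_right e1 (show 0 ≤ 3 * ((Iu + Iv) + IY) by positivity)
    have e3 := mul_le_mul_of_nonneg_right hε2 (show 0 ≤ C₀ ^ 2 * IY by positivity)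
    linarith
  have e1 := mul_le_mul_of_nonneg_right ha hIY
  have e2 : (b + 3 * C₀ ^ 2) * ε ^ 2 ≤ p :=
    (mul_le_mul_of_nonneg_left hε2 (by positivity)).trans hb
  have e3 := mul_le_mul_of_nonneg_right e2 hIv
  linarith

lemma sum_sq_le_sq_sum {a₁ a₂ a₃ a₄ a₅ a₆ : ℝ} (h₁ : 0 ≤ a₁) (h₂ : 0 ≤ a₂) (h₃ : 0 ≤ a₃)
    (h₄ : 0 ≤ a₄) (h₅ : 0 ≤ a₅) (h₆ : 0 ≤ a₆) :
    a₁ ^ 2 + a₂ ^ 2 + a₃ ^ 2 + a₄ ^ 2 + a₅ ^ 2 + a₆ ^ 2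
      ≤ (a₁ + a₂ + a₃ + (a₄ + a₅) + a₆) ^ 2 := by
  have e : 0 ≤ 2 * (a₁ * (a₂ + a₃ + a₄ + a₅ + a₆) + a₂ * (a₃ + a₄ + a₅ + a₆)
    + a₃ * (a₄ + a₅ + a₆) + a₄ * (a₅ + a₆) + a₅ * a₆) := by positivity
  linarith

lemma le_sqrt_mul {x s G : ℝ} (hG : 0 ≤ G) (hs : 0 ≤ s) (h : x ^ 2 ≤ G * s ^ 2) :
    x ≤ Real.sqrt G * s := by
  refine le_of_sq_le_sq ?_ (by positivity)
  rwa [mul_pow, Real.sq_sqrt hG]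

lemma le_sq_mul_sq_of_sqrt_le_mul_rpow {J C₀ ε : ℝ} (hC₀ : 0 ≤ C₀) (hε : 0 < ε)
    (hε1 : ε ≤ 1) (hJ : Real.sqrt J ≤ C₀ * ε ^ ((5 : ℝ) / 2)) : J ≤ C₀ ^ 2 * ε ^ 2 := by
  have h1 : ε ^ ((5 : ℝ) / 2) ≤ ε := by
    simpa using Real.rpow_le_rpow_of_exponent_ge hε hε1 (show (1 : ℝ) ≤ 5 / 2 by norm_num)
  have h2 : Real.sqrt J ≤ C₀ * ε := hJ.trans (mul_le_mul_of_nonneg_left h1 hC₀)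
  rw [Real.sqrt_le_left (by positivity)] at h2
  linarith

end Absorption

section WeightedNorm

variable {ι κ : Type*} [Fintype ι] [Fintype κ]

lemma L2v_nonneg (f : ℝ → ι → ℝ) : 0 ≤ L2v f := Real.sqrt_nonneg _

lemma L2v_expWeight_smul_sq (δ ε : ℝ) (f : ℝ → ι → ℝ) :
    L2v (fun x => expWeight δ ε x • f x) ^ 2 = ∫ x, expWeight δ ε x ^ 2 * eNorm (f x) ^ 2 := by
  simp only [L2v, sum_smul_sq]
  exact Real.sq_sqrt (integral_nonneg fun x => by positivity)

lemma integrable_of_integrable_sumElim {w : ℝ → ℝ} {u : ℝ → ι → ℝ} {v : ℝ → κ → ℝ}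
    (hw : Continuous w) (hu : Continuous u) (hv : Continuous v)
    (h : Integrable fun x => w x ^ 2 * eNorm (Sum.elim (u x) (v x)) ^ 2) :
    (Integrable fun x => w x ^ 2 * eNorm (u x) ^ 2) ∧
      Integrable fun x => w x ^ 2 * eNorm (v x) ^ 2 := by
  have hcu := continuous_eNorm hu
  have hcv := continuous_eNorm hv
  simp only [eNorm_sumElim_sq] at h
  constructor
  · refine h.mono' (by fun_prop) (Filter.Eventually.of_forall fun x => ?_)
    rw [Real.norm_of_nonneg (by positivity)]
    exact mul_le_mul_of_nonneg_left (le_add_of_nonneg_right (sq_nonneg _)) (sq_nonneg _)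
  · refine h.mono' (by fun_prop) (Filter.Eventually.of_forall fun x => ?_)
    rw [Real.norm_of_nonneg (by positivity)]
    exact mul_le_mul_of_nonneg_left (le_add_of_nonneg_left (sq_nonneg _)) (sq_nonneg _)

end WeightedNorm

/-- **Proposition 6.1 of the paper: the exponentially weighted H¹
Kawashima-type energy estimate**, uniform in the weight rate `δ ∈ [0, δ₀]` and in
`ε ∈ (0, ε₀]`, for the symmetrized linearized traveling-wave ODE
`A U' − Q U + ε² M U = (f', g)` with `Q = diag(0, Q22)`. -/
theorem weighted_H1_energy_estimate (n r : ℕ) (hn : 1 ≤ n) (hr : 1 ≤ r)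
    (c C₀ : ℝ) (hc : 0 < c) (hC₀ : 0 < C₀) :
    ∃ ε₀ δ₀ C : ℝ, 0 < ε₀ ∧ 0 < δ₀ ∧ 0 < C ∧
    ∀ ε : ℝ, ε ∈ Ioc (0 : ℝ) ε₀ → ∀ δ : ℝ, δ ∈ Icc (0 : ℝ) δ₀ →
    ∀ A K M : ℝ → Matrix (Fin n ⊕ Fin r) (Fin n ⊕ Fin r) ℝ,
    ∀ Q22 : ℝ → Matrix (Fin r) (Fin r) ℝ,
    (∀ i j, ContDiff ℝ 1 fun x => A x i j) →
    (∀ i j, ContDiff ℝ 1 fun x => K x i j) →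
    (∀ i j, ContDiff ℝ 1 fun x => M x i j) →
    (∀ i j, ContDiff ℝ 1 fun x => Q22 x i j) →
    (∀ x, (A x).IsSymm) →
    (∀ x, (K x)ᵀ = -(K x)) →
    (∀ x y, eNorm (A x *ᵥ y) ≤ C₀ * eNorm y) →
    (∀ x y, eNorm (K x *ᵥ y) ≤ C₀ * eNorm y) →
    (∀ x y, eNorm (M x *ᵥ y) ≤ C₀ * eNorm y) →
    (∀ x (w : Fin r → ℝ), eNorm (Q22 x *ᵥ w) ≤ C₀ * eNorm w) →
    (∀ x (w : Fin r → ℝ), w ⬝ᵥ (Q22 x *ᵥ w) ≤ -c * ∑ i, w i ^ 2) →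
    (∀ x (W : Fin n ⊕ Fin r → ℝ),
      c * ∑ j, W j ^ 2 ≤
        W ⬝ᵥ ((K x * A x - Matrix.fromBlocks 0 0 0 (Q22 x)) *ᵥ W)) →
    (∀ x y, eNorm (derivM A x *ᵥ y) ≤ C₀ * ε ^ 2 * eNorm y) →
    (∀ x (w : Fin r → ℝ), eNorm (derivM Q22 x *ᵥ w) ≤ C₀ * ε ^ 2 * eNorm w) →
    (∀ x y, eNorm (derivM K x *ᵥ y) ≤ C₀ * ε ^ 2 * eNorm y) →
    (∃ mbd : ℝ → ℝ, (∀ x y, eNorm (derivM M x *ᵥ y) ≤ mbd x * eNorm y) ∧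
      Integrable (fun x => mbd x ^ 2) ∧
      Real.sqrt (∫ x : ℝ, mbd x ^ 2) ≤ C₀ * ε ^ ((5 : ℝ) / 2)) →
    ∀ (f : ℝ → Fin n → ℝ) (g : ℝ → Fin r → ℝ)
      (u : ℝ → Fin n → ℝ) (v : ℝ → Fin r → ℝ),
    ContDiff ℝ 2 f → ContDiff ℝ 1 g → ContDiff ℝ 1 u → ContDiff ℝ 1 v →
    (∀ j ≤ 2, Integrable (fun x => ∑ i, (expWeight δ ε x • iteratedDeriv j f x) i ^ 2)) →
    (∀ j ≤ 1, Integrable (fun x => ∑ i, (expWeight δ ε x • iteratedDeriv j g x) i ^ 2)) →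
    Integrable (fun x => ∑ i, (expWeight δ ε x • Sum.elim (u x) (v x)) i ^ 2) →
    Integrable (fun x =>
      ∑ i, (expWeight δ ε x • Sum.elim (deriv u x) (deriv v x)) i ^ 2) →
    (∀ x, A x *ᵥ Sum.elim (deriv u x) (deriv v x)
        - Matrix.fromBlocks 0 0 0 (Q22 x) *ᵥ Sum.elim (u x) (v x)
        + ε ^ 2 • (M x *ᵥ Sum.elim (u x) (v x))
        = Sum.elim (deriv f x) (g x)) →
    L2v (fun x => expWeight δ ε x • Sum.elim (deriv u x) (deriv v x))
      + L2v (fun x => expWeight δ ε x • v x) ≤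
      C * ((∑ j ∈ Finset.range 3,
              L2v (fun x => expWeight δ ε x • iteratedDeriv j f x))
        + (∑ j ∈ Finset.range 2,
              L2v (fun x => expWeight δ ε x • iteratedDeriv j g x))
        + ε * L2v (fun x => expWeight δ ε x • u x)) := by
  set k := 3 * C₀ ^ 2 * (C₀ ^ 2 + 1) / c ^ 2 + 2 * C₀ / c with hk
  have hk0 : 0 < k := by positivity
  set B := 1 / 2 + 8 * k / c + 2 / c + c / 4
  have hB0 : 0 < B := by positivity
  set a := 3 * C₀ + 1
  have ha0 : 0 < a := by positivity
  set b := 2 * C₀ + 1 + 2 * C₀ ^ 2 / c + 32 * C₀ ^ 2 + c / 4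
  have hb0 : 0 < b := by positivity
  set q := min (c / 8) (c / (8 * k))
  have hq0 : 0 < q := lt_min (by positivity) (by positivity)
  set G := (B + (b + 3 * C₀ ^ 2)) / q with hG
  have hG0 : 0 < G := by positivity
  refine ⟨min 1 (min (c / (16 * k) / (a + 3 * C₀ ^ 2)) (c / 8 / (b + 3 * C₀ ^ 2))), 1,
    2 * Real.sqrt G, by positivity, one_pos, by positivity, ?_⟩
  intro ε hε δ hδ A K M Q22 hA1 _ hM1 hQ1 hsymm _ hA hK hM hQ hQc hKA hdA hdQ _ hmbd f g u v
    hf hg hu hv hIf hIg hIU hIY heq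
  obtain ⟨hε0, hε⟩ := hε
  obtain ⟨hδ0, hδ1⟩ := hδ
  obtain ⟨m, hdM, hm, hmle⟩ := hmbd
  obtain ⟨hε1, hε⟩ := le_min_iff.1 hε
  obtain ⟨hεa, hεb⟩ := le_min_iff.1 hε
  rw [le_div_iff₀' (by positivity)] at hεa hεb
  have hit : iteratedDeriv 2 f = deriv (deriv f) := by rw [iteratedDeriv_succ, iteratedDeriv_one]
  have hIf0 := hIf 0 (by norm_num)
  have hIf1 := hIf 1 (by norm_num)
  have hIf2 := hIf 2 le_rfl
  have hIg0 := hIg 0 (by norm_num)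
  have hIg1 := hIg 1 le_rfl
  simp only [Finset.sum_range_succ, Finset.sum_range_zero, zero_add]
  simp only [sum_smul_sq, iteratedDeriv_zero, iteratedDeriv_one, hit]
    at hIf0 hIf1 hIf2 hIg0 hIg1 hIU hIY ⊢
  simp only [← eNorm_sq] at hQc hKA
  have hcu := hu.continuous_deriv_one
  have hcv := hv.continuous_deriv_one
  have hYc : Continuous fun x => Sum.elim (deriv u x) (deriv v x) := by
    refine continuous_pi ?_
    rintro (i | i)
    · exact continuous_pi_iff.1 hcu i
    · exact continuous_pi_iff.1 hcv i
  obtain ⟨hIu, hIv⟩ := integrable_of_integrable_sumElim (continuous_expWeight δ ε) hu.continuous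
    hv.continuous hIU
  have main := weighted_energy_integral_le hc hC₀ hε0 hε1 hδ0 hδ1 hk (fun _ => rfl) (fun _ => rfl)
    (hasDerivAt_derivM hA1) (hasDerivAt_derivM hM1) (hasDerivAt_derivM hQ1)
    (fun x => (hf.differentiable two_ne_zero x).hasDerivAt)
    (fun x => (hf.differentiable_deriv_two x).hasDerivAt)
    (fun x => (hg.differentiable one_ne_zero x).hasDerivAt)
    (fun x => (hu.differentiable one_ne_zero x).hasDerivAt)
    (fun x => (hv.differentiable one_ne_zero x).hasDerivAt)
    hYc hsymm hA hK hM hQ hQc hKA hdA hdQ hdM hm hIf0 hIf1 hIf2 hIg0 hIg1 hIv hIU hIY heq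
  have hIUuv : ∫ x, expWeight δ ε x ^ 2 * eNorm (Sum.elim (u x) (v x)) ^ 2
      = (∫ x, expWeight δ ε x ^ 2 * eNorm (u x) ^ 2)
        + ∫ x, expWeight δ ε x ^ 2 * eNorm (v x) ^ 2 := by
    simp only [eNorm_sumElim_sq, mul_add]
    exact integral_add hIu hIv
  rw [hIUuv] at main
  simp only [← L2v_expWeight_smul_sq] at main
  have hJ := le_sq_mul_sq_of_sqrt_le_mul_rpow hC₀.le hε0 hε1 hmle
  have absorbed := absorbed_energy_le (B := B) (p := c / 8) (q := c / (16 * k))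
    (d := 3 * c / (16 * k)) hC₀ hε0 hε1 (sq_nonneg _) (sq_nonneg _) (sq_nonneg _) hεa hεb hb0 hJ
    (le_trans (le_of_eq (by ring)) main)
  have hd : 3 * c / (16 * k) - c / (16 * k) = c / (8 * k) := by
    field_simp
    norm_num
  rw [hd] at absorbed
  set Y := L2v fun x => expWeight δ ε x • Sum.elim (deriv u x) (deriv v x)
  set V := L2v fun x => expWeight δ ε x • v x
  set N := L2v fun x => expWeight δ ε x • u x
  set F₀ := L2v fun x => expWeight δ ε x • f x
  set F₁ := L2v fun x => expWeight δ ε x • deriv f x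
  set F₂ := L2v fun x => expWeight δ ε x • deriv (deriv f) x
  set G₀ := L2v fun x => expWeight δ ε x • g x
  set G₁ := L2v fun x => expWeight δ ε x • deriv g x
  have hN : 0 ≤ ε * N := mul_nonneg hε0.le (L2v_nonneg _)
  have hF₀ : 0 ≤ F₀ := L2v_nonneg _
  have hF₁ : 0 ≤ F₁ := L2v_nonneg _
  have hF₂ : 0 ≤ F₂ := L2v_nonneg _
  have hG₀ : 0 ≤ G₀ := L2v_nonneg _
  have hG₁ : 0 ≤ G₁ := L2v_nonneg _
  set R := F₀ + F₁ + F₂ + (G₀ + G₁) + ε * N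
  have hR0 : 0 ≤ R := by positivity
  have hR2 := sum_sq_le_sq_sum hF₀ hF₁ hF₂ hG₀ hG₁ hN
  have hsum : q * (V ^ 2 + Y ^ 2) ≤ (B + (b + 3 * C₀ ^ 2)) * R ^ 2 := by
    have e1 : q * V ^ 2 ≤ c / 8 * V ^ 2 :=
      mul_le_mul_of_nonneg_right (min_le_left _ _) (sq_nonneg V)
    have e2 : q * Y ^ 2 ≤ c / (8 * k) * Y ^ 2 :=
      mul_le_mul_of_nonneg_right (min_le_right _ _) (sq_nonneg Y)
    have e3 := mul_le_mul_of_nonneg_left hR2 (show 0 ≤ B + (b + 3 * C₀ ^ 2) by positivity)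
    have e4 : 0 ≤ B * (ε * N) ^ 2 := by positivity
    have e5 : 0 ≤ (b + 3 * C₀ ^ 2) * (F₀ ^ 2 + F₁ ^ 2 + F₂ ^ 2 + G₀ ^ 2 + G₁ ^ 2) := by positivity
    linarith
  have hsum' : V ^ 2 + Y ^ 2 ≤ G * R ^ 2 := by
    rw [hG, div_mul_eq_mul_div, le_div_iff₀' hq0]
    exact hsum
  have hY : Y ≤ Real.sqrt G * R := le_sqrt_mul hG0.le hR0 (by linarith [sq_nonneg V])
  have hV : V ≤ Real.sqrt G * R := le_sqrt_mul hG0.le hR0 (by linarith [sq_nonneg Y])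
  linarith
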